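/- Let T be a theory, φ a sentence with T + φ consistent, ρ a sentence, and Γ a set of sentences. Suppose that T + φ + ρ is consistent and that T + φ + ¬ρ is Γ-conservative over T + φ. Then for every π ∈ Γ, the theory T + φ + (ρ ↔ π) is consistent. (In the paper's arithmetical reading, with T = PA and Γ the Π⁰₁-sentences: if ρ(⌜φ⌝) is strongly independent over PA + φ, then ρ(⌜φ⌝) is Π⁰₁-flexible over PA + φ.) -/

import Mathlib

open FirstOrder FirstOrder.Language

/-- A theory is consistent if it does not prove `⊥`
(by completeness, provability is semantic consequence `⊨ᵇ`). -/
def TheoryConsistent {L : Language} (T : L.Theory) : Prop :=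
  ¬ T ⊨ᵇ (⊥ : L.Sentence)

/-- `S` is `Γ`-conservative over `T`: every member of `Γ` provable in `S` is provable in `T`. -/
def GammaConservative {L : Language} (Γ : Set L.Sentence) (S T : L.Theory) : Prop :=
  ∀ π ∈ Γ, S ⊨ᵇ π → T ⊨ᵇ π

/-- If `T + φ + (ρ ↔ π)` is inconsistent, any model of `T + φ` refutes `ρ ↔ π`. -/
theorem refutes_iff.{u, v} {L : FirstOrder.Language.{u, v}} (T : L.Theory) (φ ρ π : L.Sentence)
    (hbot : (T ∪ {φ} ∪ {ρ ⇔ π}) ⊨ᵇ (⊥ : L.Sentence))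
    (M : Theory.ModelType.{u, v, max u v} (T ∪ {φ})) : ¬ (M ⊨ ρ ↔ M ⊨ π) := by
  rw [Theory.models_sentence_iff] at hbot
  intro hM
  have h1 : M ⊨ (T ∪ {φ} ∪ {ρ ⇔ π} : L.Theory) := by
    refine Theory.Model.union M.is_model ?_
    rw [Theory.model_singleton_iff]
    simpa [Sentence.Realize, Formula.Realize] using hM
  exact hbot (Theory.ModelType.of (T ∪ {φ} ∪ {ρ ⇔ π}) M)

/-- If `T + φ + ρ` is consistent and `T + φ + ¬ρ` is `Γ`-conservative over `T + φ`,
then for every `π ∈ Γ`, the theory `T + φ + (ρ ↔ π)` is consistent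
(strong independence implies `Γ`-flexibility). -/
theorem strongly_independent_implies_flexible {L : Language} (T : L.Theory)
    (φ ρ : L.Sentence) (Γ : Set L.Sentence)
    (hcon : TheoryConsistent (T ∪ {φ}))
    (hρcon : TheoryConsistent (T ∪ {φ} ∪ {ρ}))
    (hcons : GammaConservative Γ (T ∪ {φ} ∪ {∼ρ}) (T ∪ {φ})) :
    ∀ π ∈ Γ, TheoryConsistent (T ∪ {φ} ∪ {ρ ⇔ π}) := by
  intro π hπ hbot
  have key := refutes_iff T φ ρ π hbot
  have hT : (T ∪ {φ}) ⊨ᵇ π := by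
    refine hcons π hπ ?_
    rw [Theory.models_sentence_iff]
    intro M
    have hM0 : M ⊨ (T ∪ {φ} : L.Theory) := M.is_model.mono Set.subset_union_left
    have hn : M ⊨ ∼ρ :=
      Theory.realize_sentence_of_mem (T ∪ {φ} ∪ {∼ρ}) (Set.mem_union_right _ rfl)
    rw [Sentence.realize_not] at hn
    by_contra hp
    exact key (Theory.ModelType.of (T ∪ {φ}) M) ⟨fun h => absurd h hn, fun h => absurd h hp⟩
  rw [Theory.models_sentence_iff] at hT
  apply hρcon
  rw [Theory.models_sentence_iff]
  intro M
  have hM0 : M ⊨ (T ∪ {φ} : L.Theory) := M.is_model.mono Set.subset_union_left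
  have hr : M ⊨ ρ :=
    Theory.realize_sentence_of_mem (T ∪ {φ} ∪ {ρ}) (Set.mem_union_right _ rfl)
  have hp := hT (Theory.ModelType.of (T ∪ {φ}) M)
  exact (key (Theory.ModelType.of (T ∪ {φ}) M) ⟨fun _ => hp, fun _ => hr⟩).elim
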